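/- Let n ≥ 1 and consider the Segre variety X = P¹ × P¹ × Pⁿ × Pⁿ, i.e. the 4-tuple (1, 1, n, n). (i) X has a defective (2n+1)-secant variety: T(1,1,n,n; 2n+1; 0,0,0,0) fails. (ii) The codimension of σ_{2n+1}(X) is exactly 2: the maximum over all choices of 2n+1 points p₁,…,p_{2n+1} of dim(Σ_j T_{p_j}) equals 4(n+1)² − 2. (iii) T(1,1,n,n; 2n; 0,0,0,0) holds and T(1,1,n,n; 2n+2; 0,0,0,0) holds (the latter meaning there exist 2n+2 points whose tangent spaces span all of V₁ ⊗ V₂ ⊗ V₃ ⊗ V₄, of dimension 4(n+1)²). -/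

import Mathlib

open scoped TensorProduct

/-- The subspace `G^i_p = v₁ ⊗ ⋯ ⊗ v_{i-1} ⊗ Vᵢ ⊗ v_{i+1} ⊗ ⋯ ⊗ v_k` of the tensor
space `⨂ᵢ K^{nᵢ+1}` attached to the point `p = v₁ ⊗ ⋯ ⊗ v_k`. -/
noncomputable def segreG (K : Type*) [Field K] {k : ℕ} (n : Fin k → ℕ)
    (v : ∀ i, Fin (n i + 1) → K) (i : Fin k) :
    Submodule K (⨂[K] i, (Fin (n i + 1) → K)) :=
  LinearMap.range ((PiTensorProduct.tprod K).toLinearMap v i)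

/-- The affine tangent space `T_p = Σᵢ v₁ ⊗ ⋯ ⊗ Vᵢ ⊗ ⋯ ⊗ v_k` to the Segre variety at
`p = v₁ ⊗ ⋯ ⊗ v_k`. -/
noncomputable def segreTangent (K : Type*) [Field K] {k : ℕ} (n : Fin k → ℕ)
    (v : ∀ i, Fin (n i + 1) → K) : Submodule K (⨂[K] i, (Fin (n i + 1) → K)) :=
  ⨆ i, segreG K n v i

/-- The statement `T(n₁,…,n_k; s; a₁,…,a_k)` of Abo–Ottaviani–Peterson holds:
there are points `p₁,…,p_s` and `q_{i,1},…,q_{i,aᵢ}` (pure tensors of nonzero vectors)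
such that the span of the tangent spaces `T_{p_j}` together with the subspaces
`G^i_{q_{i,l}}` has the expected (maximal possible) dimension
`min (s(1 + Σ nᵢ) + Σ aᵢ(nᵢ+1)) (Π (nᵢ+1))`. -/
def THolds (K : Type*) [Field K] {k : ℕ} (n : Fin k → ℕ) (s : ℕ) (a : Fin k → ℕ) : Prop :=
  ∃ (p : Fin s → ∀ i, Fin (n i + 1) → K)
    (q : ∀ i : Fin k, Fin (a i) → ∀ j, Fin (n j + 1) → K),
    (∀ j i, p j i ≠ 0) ∧ (∀ i l j, q i l j ≠ 0) ∧
    Module.finrank K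
      (((⨆ j, segreTangent K n (p j)) ⊔ (⨆ i, ⨆ l, segreG K n (q i l) i))
        : Submodule K (⨂[K] i, (Fin (n i + 1) → K)))
      = min (s * (1 + ∑ i, n i) + ∑ i, a i * (n i + 1)) (∏ i, (n i + 1))

/-- The statement `T(n₁,…,n_k; s; a₁,…,a_k)` fails: every choice of points gives a span
of dimension strictly smaller than the expected dimension. -/
def TFails (K : Type*) [Field K] {k : ℕ} (n : Fin k → ℕ) (s : ℕ) (a : Fin k → ℕ) : Prop :=
  ∀ (p : Fin s → ∀ i, Fin (n i + 1) → K)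
    (q : ∀ i : Fin k, Fin (a i) → ∀ j, Fin (n j + 1) → K),
    (∀ j i, p j i ≠ 0) → (∀ i l j, q i l j ≠ 0) →
    Module.finrank K
      (((⨆ j, segreTangent K n (p j)) ⊔ (⨆ i, ⨆ l, segreG K n (q i l) i))
        : Submodule K (⨂[K] i, (Fin (n i + 1) → K)))
      < min (s * (1 + ∑ i, n i) + ∑ i, a i * (n i + 1)) (∏ i, (n i + 1))

/-- The tuple `(n; s; a)` is subabundant. -/
def Subabundant {k : ℕ} (n : Fin k → ℕ) (s : ℕ) (a : Fin k → ℕ) : Prop :=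
  s * (1 + ∑ i, n i) + ∑ i, a i * (n i + 1) ≤ ∏ i, (n i + 1)

/-- The tuple `(n; s; a)` is superabundant. -/
def Superabundant {k : ℕ} (n : Fin k → ℕ) (s : ℕ) (a : Fin k → ℕ) : Prop :=
  ∏ i, (n i + 1) ≤ s * (1 + ∑ i, n i) + ∑ i, a i * (n i + 1)

/-- The family of four vectors whose tensor product is a point of `P¹ × P¹ × Pⁿ × Pⁿ`. -/
def segrePoint {K : Type*} {n : ℕ} (a b : Fin 2 → K) (c d : Fin (n + 1) → K) :
    ∀ i : Fin 4, Fin (![1, 1, n, n] i + 1) → K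
  | 0 => a
  | 1 => b
  | 2 => c
  | 3 => d

section SegrePoint

variable {K : Type*} {n : ℕ} (a b x : Fin 2 → K) (c d y : Fin (n + 1) → K)

theorem segrePoint_eta (v : ∀ i : Fin 4, Fin (![1, 1, n, n] i + 1) → K) :
    segrePoint (v 0) (v 1) (v 2) (v 3) = v := by
  funext i
  fin_cases i <;> rfl

theorem update_segrePoint_zero :
    Function.update (segrePoint a b c d) 0 x = segrePoint x b c d := by
  funext i
  fin_cases i <;> rfl

theorem update_segrePoint_one :
    Function.update (segrePoint a b c d) 1 x = segrePoint a x c d := by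
  funext i
  fin_cases i <;> rfl

theorem update_segrePoint_two :
    Function.update (segrePoint a b c d) 2 y = segrePoint a b y d := by
  funext i
  fin_cases i <;> rfl

theorem update_segrePoint_three :
    Function.update (segrePoint a b c d) 3 y = segrePoint a b c y := by
  funext i
  fin_cases i <;> rfl

end SegrePoint

theorem MultilinearMap.map_add_of_update_eq {R ι N : Type*} {M : ι → Type*} [DecidableEq ι]
    [Semiring R] [∀ i, AddCommMonoid (M i)] [∀ i, Module R (M i)] [AddCommMonoid N] [Module R N]
    (f : MultilinearMap R M N) {v vx vy vxy : ∀ i, M i} {i : ι} {x y : M i}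
    (hx : Function.update v i x = vx) (hy : Function.update v i y = vy)
    (hxy : Function.update v i (x + y) = vxy) : f vxy = f vx + f vy := by
  rw [← hx, ← hy, ← hxy, f.map_update_add]

theorem MultilinearMap.map_smul_of_update_eq {R ι N : Type*} {M : ι → Type*} [DecidableEq ι]
    [Semiring R] [∀ i, AddCommMonoid (M i)] [∀ i, Module R (M i)] [AddCommMonoid N] [Module R N]
    (f : MultilinearMap R M N) {v vx vtx : ∀ i, M i} {i : ι} {t : R} {x : M i}
    (hx : Function.update v i x = vx) (htx : Function.update v i (t • x) = vtx) :
    f vtx = t • f vx := by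
  rw [← hx, ← htx, f.map_update_smul]

/-- The tensor space containing the cone over `P¹ × P¹ × Pⁿ × Pⁿ`. -/
abbrev SegreSpace (K : Type*) [Field K] (n : ℕ) : Type _ :=
  ⨂[K] i, (Fin (![1, 1, n, n] i + 1) → K)

/-- The pure tensor `a ⊗ b ⊗ c ⊗ d`, as a linear map in each of the four vectors. -/
noncomputable def segreTensor (K : Type*) [Field K] (n : ℕ) :
    (Fin 2 → K) →ₗ[K] (Fin 2 → K) →ₗ[K] (Fin (n + 1) → K) →ₗ[K] (Fin (n + 1) → K) →ₗ[K]
      SegreSpace K n :=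
  LinearMap.mk₂ K
    (fun a b => LinearMap.mk₂ K
      (fun c d => PiTensorProduct.tprod K (segrePoint a b c d))
      (fun c c' d => (PiTensorProduct.tprod K).map_add_of_update_eq
        (update_segrePoint_two a b c d c) (update_segrePoint_two a b c d c')
        (update_segrePoint_two a b c d (c + c')))
      (fun t c d => (PiTensorProduct.tprod K).map_smul_of_update_eq
        (update_segrePoint_two a b c d c) (update_segrePoint_two a b c d (t • c)))
      (fun c d d' => (PiTensorProduct.tprod K).map_add_of_update_eq
        (update_segrePoint_three a b c d d) (update_segrePoint_three a b c d d')
        (update_segrePoint_three a b c d (d + d')))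
      (fun t c d => (PiTensorProduct.tprod K).map_smul_of_update_eq
        (update_segrePoint_three a b c d d) (update_segrePoint_three a b c d (t • d))))
    (fun a a' b => LinearMap.ext₂ fun c d => (PiTensorProduct.tprod K).map_add_of_update_eq
      (update_segrePoint_zero a b a c d) (update_segrePoint_zero a b a' c d)
      (update_segrePoint_zero a b (a + a') c d))
    (fun t a b => LinearMap.ext₂ fun c d => (PiTensorProduct.tprod K).map_smul_of_update_eq
      (update_segrePoint_zero a b a c d) (update_segrePoint_zero a b (t • a) c d))
    (fun a b b' => LinearMap.ext₂ fun c d => (PiTensorProduct.tprod K).map_add_of_update_eq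
      (update_segrePoint_one a b b c d) (update_segrePoint_one a b b' c d)
      (update_segrePoint_one a b (b + b') c d))
    (fun t a b => LinearMap.ext₂ fun c d => (PiTensorProduct.tprod K).map_smul_of_update_eq
      (update_segrePoint_one a b b c d) (update_segrePoint_one a b (t • b) c d))

section SegreTensor

variable {K : Type*} [Field K] {n : ℕ}

theorem segreTensor_apply (a b : Fin 2 → K) (c d : Fin (n + 1) → K) :
    segreTensor K n a b c d = PiTensorProduct.tprod K (segrePoint a b c d) := rfl

theorem segreTangent_segrePoint (a b : Fin 2 → K) (c d : Fin (n + 1) → K) :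
    segreTangent K ![1, 1, n, n] (segrePoint a b c d) =
      LinearMap.range (((segreTensor K n).flip b).flip c |>.flip d) ⊔
      LinearMap.range ((segreTensor K n a).flip c |>.flip d) ⊔
      LinearMap.range ((segreTensor K n a b).flip d) ⊔
      LinearMap.range (segreTensor K n a b c) := by
  have h0 : (PiTensorProduct.tprod K).toLinearMap (segrePoint a b c d) 0 =
      (((segreTensor K n).flip b).flip c |>.flip d) :=
    LinearMap.ext fun x => congrArg (PiTensorProduct.tprod K) (update_segrePoint_zero a b x c d)
  have h1 : (PiTensorProduct.tprod K).toLinearMap (segrePoint a b c d) 1 =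
      ((segreTensor K n a).flip c |>.flip d) :=
    LinearMap.ext fun x => congrArg (PiTensorProduct.tprod K) (update_segrePoint_one a b x c d)
  have h2 : (PiTensorProduct.tprod K).toLinearMap (segrePoint a b c d) 2 =
      ((segreTensor K n a b).flip d) :=
    LinearMap.ext fun x => congrArg (PiTensorProduct.tprod K) (update_segrePoint_two a b c d x)
  have h3 : (PiTensorProduct.tprod K).toLinearMap (segrePoint a b c d) 3 =
      (segreTensor K n a b c) :=
    LinearMap.ext fun x => congrArg (PiTensorProduct.tprod K) (update_segrePoint_three a b c d x)
  rw [← h0, ← h1, ← h2, ← h3]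
  apply le_antisymm
  · refine iSup_le fun i => ?_
    fin_cases i
    · exact le_sup_of_le_left (le_sup_of_le_left le_sup_left)
    · exact le_sup_of_le_left (le_sup_of_le_left le_sup_right)
    · exact le_sup_of_le_left le_sup_right
    · exact le_sup_right
  · refine sup_le (sup_le (sup_le ?_ ?_) ?_) ?_
    · exact le_iSup (segreG K ![1, 1, n, n] (segrePoint a b c d)) 0
    · exact le_iSup (segreG K ![1, 1, n, n] (segrePoint a b c d)) 1
    · exact le_iSup (segreG K ![1, 1, n, n] (segrePoint a b c d)) 2
    · exact le_iSup (segreG K ![1, 1, n, n] (segrePoint a b c d)) 3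

theorem segreTangent_le_iff {a b : Fin 2 → K} {c d : Fin (n + 1) → K}
    {S : Submodule K (SegreSpace K n)} :
    segreTangent K ![1, 1, n, n] (segrePoint a b c d) ≤ S ↔
      (∀ x, segreTensor K n x b c d ∈ S) ∧ (∀ x, segreTensor K n a x c d ∈ S) ∧
      (∀ y, segreTensor K n a b y d ∈ S) ∧ (∀ y, segreTensor K n a b c y ∈ S) := by
  rw [segreTangent_segrePoint]
  simp only [sup_le_iff, and_assoc, LinearMap.range_le_iff_comap, Submodule.eq_top_iff',
    Submodule.mem_comap, LinearMap.flip_apply]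

theorem segreTensor_dual_ext {F : Module.Dual K (SegreSpace K n)}
    (h : ∀ a b c d, F (segreTensor K n a b c d) = 0) : F = 0 := by
  refine PiTensorProduct.ext (MultilinearMap.ext fun v => ?_)
  exact (congrArg (fun w => F (PiTensorProduct.tprod K w)) (segrePoint_eta v)).symm.trans
    (h (v 0) (v 1) (v 2) (v 3))

/-- The linear functional on the tensor space attached to a form in four vectors. -/
noncomputable def segreLift
    (q : (Fin 2 → K) →ₗ[K] (Fin 2 → K) →ₗ[K] (Fin (n + 1) → K) →ₗ[K] (Fin (n + 1) → K) →ₗ[K] K) :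
    Module.Dual K (SegreSpace K n) :=
  PiTensorProduct.lift
    { toFun := fun v => q (v 0) (v 1) (v 2) (v 3)
      map_update_add' := fun {inst} v i x y => by
        obtain rfl : inst = instDecidableEqFin 4 := Subsingleton.elim _ _
        fin_cases i
        · exact LinearMap.congr_fun₂ (LinearMap.map_add₂ q x y (v 1)) (v 2) (v 3)
        · exact LinearMap.congr_fun₂ ((q (v 0)).map_add x y) (v 2) (v 3)
        · exact LinearMap.map_add₂ (q (v 0) (v 1)) x y (v 3)
        · exact (q (v 0) (v 1) (v 2)).map_add x y
      map_update_smul' := fun {inst} v i t x => by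
        obtain rfl : inst = instDecidableEqFin 4 := Subsingleton.elim _ _
        fin_cases i
        · exact LinearMap.congr_fun₂ (LinearMap.map_smul₂ q t x (v 1)) (v 2) (v 3)
        · exact LinearMap.congr_fun₂ ((q (v 0)).map_smul t x) (v 2) (v 3)
        · exact LinearMap.map_smul₂ (q (v 0) (v 1)) t x (v 3)
        · exact (q (v 0) (v 1) (v 2)).map_smul t x }

@[simp]
theorem segreLift_segreTensor
    (q : (Fin 2 → K) →ₗ[K] (Fin 2 → K) →ₗ[K] (Fin (n + 1) → K) →ₗ[K] (Fin (n + 1) → K) →ₗ[K] K)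
    (a b : Fin 2 → K) (c d : Fin (n + 1) → K) :
    segreLift q (segreTensor K n a b c d) = q a b c d := by
  rw [segreTensor_apply, segreLift, PiTensorProduct.lift.tprod]
  rfl

/-- The functional `a ⊗ b ⊗ c ⊗ d ↦ f(a, c) g(b, d)`. -/
noncomputable def segreFunctional₁₃ (f g : (Fin 2 → K) →ₗ[K] (Fin (n + 1) → K) →ₗ[K] K) :
    Module.Dual K (SegreSpace K n) :=
  segreLift <| LinearMap.mk₂ K
    (fun a b => LinearMap.mk₂ K (fun c d => f a c * g b d)
      (fun c c' d => by simp [add_mul]) (fun t c d => by simp [mul_assoc])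
      (fun c d d' => by simp [mul_add]) (fun t c d => by simp [mul_left_comm]))
    (fun a a' b => by ext; simp [add_mul]) (fun t a b => by ext; simp [mul_assoc])
    (fun a b b' => by ext; simp [mul_add]) (fun t a b => by ext; simp [mul_left_comm])

/-- The functional `a ⊗ b ⊗ c ⊗ d ↦ f(a, d) g(b, c)`. -/
noncomputable def segreFunctional₁₄ (f g : (Fin 2 → K) →ₗ[K] (Fin (n + 1) → K) →ₗ[K] K) :
    Module.Dual K (SegreSpace K n) :=
  segreLift <| LinearMap.mk₂ K
    (fun a b => LinearMap.mk₂ K (fun c d => f a d * g b c)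
      (fun c c' d => by simp [mul_add]) (fun t c d => by simp [mul_left_comm])
      (fun c d d' => by simp [add_mul]) (fun t c d => by simp [mul_assoc]))
    (fun a a' b => by ext; simp [add_mul]) (fun t a b => by ext; simp [mul_assoc])
    (fun a b b' => by ext; simp [mul_add]) (fun t a b => by ext; simp [mul_left_comm])

@[simp]
theorem segreFunctional₁₃_segreTensor (f g : (Fin 2 → K) →ₗ[K] (Fin (n + 1) → K) →ₗ[K] K)
    (a b : Fin 2 → K) (c d : Fin (n + 1) → K) :
    segreFunctional₁₃ f g (segreTensor K n a b c d) = f a c * g b d := by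
  simp [segreFunctional₁₃]

@[simp]
theorem segreFunctional₁₄_segreTensor (f g : (Fin 2 → K) →ₗ[K] (Fin (n + 1) → K) →ₗ[K] K)
    (a b : Fin 2 → K) (c d : Fin (n + 1) → K) :
    segreFunctional₁₄ f g (segreTensor K n a b c d) = f a d * g b c := by
  simp [segreFunctional₁₄]

theorem finrank_segreSpace : Module.finrank K (SegreSpace K n) = 4 * (n + 1) ^ 2 := by
  rw [Module.finrank_eq_card_basis (Basis.piTensorProduct fun i => Pi.basisFun K _)]
  simp [Fin.prod_univ_four]
  ring

end SegreTensor

section Configuration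

variable {K : Type*} [Field K]

/-- Pencils `G₀ + t G₁` and `H₀ + t H₁` of bilinear forms, evaluated on a frame `u, e j`: the
vanishing conditions imposed by the tangent spaces at `segreBase` and `segreExtra` and by two
further coordinates leave no nonzero pair of pencils. -/
theorem bilinear_pencils_eq_zero {V : Type*} [AddCommGroup V] [Module K V] [CharZero K] {n : ℕ}
    (u : V) (e : Fin n → V) (k : Fin n) (hk : (k : ℕ) = 0)
    (G₀ G₁ H₀ H₁ : V →ₗ[K] V →ₗ[K] K)
    (hG₁ : ∀ j, G₁ (e j) (e j) = 0)
    (hGl : ∀ j x, G₀ x (e j) + (j : ℕ) * G₁ x (e j) = 0)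
    (hGr : ∀ j y, G₀ (e j) y + (j : ℕ) * G₁ (e j) y = 0)
    (hHG : ∀ j, H₀ (e j) (e j) + (j : ℕ) * H₁ (e j) (e j) = 0)
    (hH₀ : ∀ j, H₀ (u + e j) (u + e j) = 0) (hH₁ : ∀ j, H₁ (u + e j) (u + e j) = 0)
    (hHl : ∀ j x, H₀ x (u + e j) + ((j : ℕ) + 1) * H₁ x (u + e j) = 0)
    (hHr : ∀ j y, H₀ (u + e j) y + ((j : ℕ) + 1) * H₁ (u + e j) y = 0)
    (hGH : ∀ j, G₀ (u + e j) (u + e j) + ((j : ℕ) + 1) * G₁ (u + e j) (u + e j) = 0)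
    (hG : G₁ (u + e k) (e k) = 0) (hH : H₁ (u + e k) (e k) = 0)
    (hl : ∀ x, G₁ x (e k) + H₁ x (e k) = 0)
    (hr : ∀ y, G₁ (u + e k) y + H₁ (u + e k) y = 0)
    (hGu : G₁ u u = 0) (hHu : H₁ u u = 0) :
    ∀ v ∈ insert u (Set.range e), ∀ w ∈ insert u (Set.range e),
      G₀ v w = 0 ∧ G₁ v w = 0 ∧ H₀ v w = 0 ∧ H₁ v w = 0 := by
  have hne : ∀ {i j : Fin n}, i ≠ j → ((i : ℕ) : K) - (j : ℕ) ≠ 0 := fun h =>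
    sub_ne_zero.2 fun h' => h (Fin.ext (Nat.cast_injective h'))
  simp only [map_add, LinearMap.add_apply] at *
  have hk' : ((k : ℕ) : K) = 0 := by simp [hk]
  have G1ij : ∀ i j, G₁ (e i) (e j) = 0 := by
    intro i j
    by_cases h : i = j
    · rw [h, hG₁]
    · exact (mul_eq_zero.1 (by linear_combination hGr i (e j) - hGl j (e i) :
        ((i : ℕ) - (j : ℕ) : K) * G₁ (e i) (e j) = 0)).resolve_left (hne h)
  have G0ij : ∀ i j, G₀ (e i) (e j) = 0 := fun i j => by
    linear_combination hGl j (e i) - (j : ℕ) * G1ij i j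
  have H1ij : ∀ i j, H₁ u u + H₁ (e i) u + (H₁ u (e j) + H₁ (e i) (e j)) = 0 := by
    intro i j
    by_cases h : i = j
    · rw [h]
      exact hH₁ j
    · refine (mul_eq_zero.1 (?_ : ((i : ℕ) - (j : ℕ) : K) * _ = 0)).resolve_left (hne h)
      linear_combination hHr i u + hHr i (e j) - hHl j u - hHl j (e i)
  have G1uk : G₁ u (e k) = 0 := by linear_combination hG - G1ij k k
  have H1jk : ∀ j, H₁ (e j) (e k) = 0 := fun j => by linear_combination hl (e j) - G1ij j k
  have H1uk : H₁ u (e k) = 0 := by linear_combination hl u - G1uk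
  have H1ju : ∀ j, H₁ (e j) u = 0 := fun j => by
    linear_combination H1ij j k - H1jk j - H1uk - hHu
  have G1uj : ∀ j, G₁ u (e j) = 0 := fun j => by
    linear_combination hr (e j) - G1ij k j - H1ij k j + hHu + H1ju k
  have G1ku : G₁ (e k) u = 0 := by
    linear_combination hr u - hGu - hHu - H1ju k
  have G0uj : ∀ j, G₀ u (e j) = 0 := fun j => by
    linear_combination hGl j u - (j : ℕ) * G1uj j
  have G1ju' : ∀ j, G₁ (e j) u + G₀ u u = 0 := fun j => by
    linear_combination hGH j - hGr j u - G0uj j - G0ij j j -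
      ((j : ℕ) + 1) * (hGu + G1uj j + G1ij j j)
  have G0uu : G₀ u u = 0 := by linear_combination G1ju' k - G1ku
  have G1ju : ∀ j, G₁ (e j) u = 0 := fun j => by linear_combination G1ju' j - G0uu
  have G0ju : ∀ j, G₀ (e j) u = 0 := fun j => by
    linear_combination hGr j u - (j : ℕ) * G1ju j
  have H0uj : ∀ j, H₀ u u + H₀ u (e j) + ((j : ℕ) + 1) * H₁ u (e j) = 0 := fun j => by
    linear_combination hHl j u - ((j : ℕ) + 1) * hHu
  have H0ju : ∀ j, H₀ u u + H₀ (e j) u = 0 := fun j => by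
    linear_combination hHr j u - ((j : ℕ) + 1) * (hHu + H1ju j)
  have H1uj' : ∀ j, H₁ u (e j) + H₀ u u = 0 := fun j => by
    linear_combination hHG j - (j : ℕ) * (H1ij j j) + (j : ℕ) * (hHu + H1ju j) - hH₀ j +
      H0ju j + H0uj j
  have H0uu : H₀ u u = 0 := by linear_combination H1uj' k - H1uk
  have H1uj : ∀ j, H₁ u (e j) = 0 := fun j => by linear_combination H1uj' j - H0uu
  have H0uj' : ∀ j, H₀ u (e j) = 0 := fun j => by
    linear_combination H0uj j - H0uu - ((j : ℕ) + 1) * H1uj j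
  have H0ju' : ∀ j, H₀ (e j) u = 0 := fun j => by linear_combination H0ju j - H0uu
  have H1ij' : ∀ i j, H₁ (e i) (e j) = 0 := fun i j => by
    linear_combination H1ij i j - hHu - H1ju i - H1uj j
  have H0ij : ∀ i j, H₀ (e i) (e j) = 0 := fun i j => by
    linear_combination hHl j (e i) - H0ju' i - ((j : ℕ) + 1) * (H1ju i + H1ij' i j)
  rintro v (rfl | ⟨i, rfl⟩) w (rfl | ⟨j, rfl⟩) <;> simp [*]

variable (K)

/-- `2n` points of `P¹ × P¹ × Pⁿ × Pⁿ` whose tangent spaces are independent. -/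
def segreBase (n : ℕ) : Fin n ⊕ Fin n → ∀ i : Fin 4, Fin (![1, 1, n, n] i + 1) → K
  | .inl j => segrePoint (Pi.single 0 1) (Pi.single 0 1 + ((j : ℕ) : K) • Pi.single 1 1)
      (Pi.single j.succ 1) (Pi.single j.succ 1)
  | .inr j => segrePoint (Pi.single 1 1) (Pi.single 0 1 + ((j : ℕ) + 1 : K) • Pi.single 1 1)
      (Pi.single 0 1 + Pi.single j.succ 1) (Pi.single 0 1 + Pi.single j.succ 1)

/-- A point which together with `segreBase` gives `2n + 1` points whose tangent spaces span a
subspace of codimension two. -/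
def segreExtra {n : ℕ} (k : Fin n) : ∀ i : Fin 4, Fin (![1, 1, n, n] i + 1) → K :=
  segrePoint (Pi.single 0 1 + Pi.single 1 1) (Pi.single 1 1)
    (Pi.single 0 1 + Pi.single k.succ 1) (Pi.single k.succ 1)

variable {K}

theorem segrePoint_ne_zero {n : ℕ} {a b : Fin 2 → K} {c d : Fin (n + 1) → K} (ha : a ≠ 0)
    (hb : b ≠ 0) (hc : c ≠ 0) (hd : d ≠ 0) (i : Fin 4) : segrePoint a b c d i ≠ 0 := by
  fin_cases i
  exacts [ha, hb, hc, hd]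

theorem segreBase_ne_zero {n : ℕ} (j : Fin n ⊕ Fin n) (i : Fin 4) : segreBase K n j i ≠ 0 := by
  rcases j with j | j
  · exact segrePoint_ne_zero (fun h => by simpa using congrFun h 0)
      (fun h => by simpa using congrFun h 0) (fun h => by simpa using congrFun h j.succ)
      (fun h => by simpa using congrFun h j.succ) i
  · exact segrePoint_ne_zero (fun h => by simpa using congrFun h 1)
      (fun h => by simpa using congrFun h 0) (fun h => by simpa using congrFun h j.succ)
      (fun h => by simpa using congrFun h j.succ) i

theorem segreExtra_ne_zero {n : ℕ} (k : Fin n) (i : Fin 4) : segreExtra K k i ≠ 0 :=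
  segrePoint_ne_zero (fun h => by simpa using congrFun h 0)
    (fun h => by simpa using congrFun h 1) (fun h => by simpa using congrFun h k.succ)
    (fun h => by simpa using congrFun h k.succ) i

theorem segreTensor_dual_ext_single {n : ℕ} {F : Module.Dual K (SegreSpace K n)}
    (h : ∀ a b c d, F (segreTensor K n (Pi.single a 1) (Pi.single b 1) (Pi.single c 1)
      (Pi.single d 1)) = 0) : F = 0 := by
  refine segreTensor_dual_ext fun a b c d => ?_
  rw [pi_eq_sum_univ' a, pi_eq_sum_univ' b, pi_eq_sum_univ' c, pi_eq_sum_univ' d]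
  simp only [map_sum, map_smul, LinearMap.sum_apply, LinearMap.smul_apply, h, smul_zero,
    Finset.sum_const_zero]

theorem eq_top_of_segreTangent_le [CharZero K] {n : ℕ} {k : Fin n} (hk : (k : ℕ) = 0)
    {S : Submodule K (SegreSpace K n)}
    (hB : ∀ j, segreTangent K ![1, 1, n, n] (segreBase K n j) ≤ S)
    (hE : segreTangent K ![1, 1, n, n] (segreExtra K k) ≤ S)
    (h : ∀ a, segreTensor K n (Pi.single a 1) (Pi.single 1 1) (Pi.single 0 1) (Pi.single 0 1) ∈ S) :
    S = ⊤ := by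
  by_contra hS
  obtain ⟨F, hF, hSF⟩ := S.exists_le_ker_of_lt_top (lt_top_iff_ne_top.2 hS)
  refine hF (segreTensor_dual_ext_single ?_)
  have hl := fun j => segreTangent_le_iff.1 ((hB (.inl j)).trans hSF)
  have hr := fun j => segreTangent_le_iff.1 ((hB (.inr j)).trans hSF)
  have he := segreTangent_le_iff.1 (hE.trans hSF)
  have h' := fun a => hSF (h a)
  simp only [LinearMap.mem_ker] at hl hr he h'
  have hadd : ∀ a b b' t c d, F (segreTensor K n a (b + t • b') c d) =
      F (segreTensor K n a b c d) + t * F (segreTensor K n a b' c d) := by simp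
  have hadd' : ∀ a a' b c d, F (segreTensor K n (a + a') b c d) =
      F (segreTensor K n a b c d) + F (segreTensor K n a' b c d) := by simp
  have key := bilinear_pencils_eq_zero (Pi.single 0 1) (fun j : Fin n => Pi.single j.succ (1 : K))
    k hk
    ((segreTensor K n (Pi.single 0 1) (Pi.single 0 1)).compr₂ F)
    ((segreTensor K n (Pi.single 0 1) (Pi.single 1 1)).compr₂ F)
    ((segreTensor K n (Pi.single 1 1) (Pi.single 0 1)).compr₂ F)
    ((segreTensor K n (Pi.single 1 1) (Pi.single 1 1)).compr₂ F)
    (fun j => (hl j).2.1 _)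
    (fun j x => by simpa using (hl j).2.2.1 x)
    (fun j y => by simpa using (hl j).2.2.2 y)
    (fun j => by simpa using (hl j).1 (Pi.single 1 1))
    (fun j => (hr j).2.1 _) (fun j => (hr j).2.1 _)
    (fun j x => (hadd ..).symm.trans ((hr j).2.2.1 x))
    (fun j y => (hadd ..).symm.trans ((hr j).2.2.2 y))
    (fun j => (hadd ..).symm.trans ((hr j).1 (Pi.single 0 1)))
    (he.1 _) (he.1 _)
    (fun x => (hadd' ..).symm.trans (he.2.2.1 x))
    (fun y => (hadd' ..).symm.trans (he.2.2.2 y))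
    (h' 0) (h' 1)
  have hmem : ∀ c : Fin (n + 1), (Pi.single c 1 : Fin (n + 1) → K) ∈
      insert (Pi.single 0 1) (Set.range fun j : Fin n => Pi.single j.succ (1 : K)) := fun c =>
    c.cases (Or.inl rfl) fun j => Or.inr ⟨j, rfl⟩
  intro a b c d
  obtain ⟨h₁, h₂, h₃, h₄⟩ := key _ (hmem c) _ (hmem d)
  fin_cases a <;> fin_cases b
  exacts [h₁, h₂, h₃, h₄]

end Configuration

section Dimension

variable {K : Type*} [Field K]

theorem LinearMap.exists_range_le_span_singleton_sup {V M : Type*} [AddCommGroup V] [Module K V]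
    [FiniteDimensional K V] [AddCommGroup M] [Module K M] (L : V →ₗ[K] M) {v : V} (hv : v ≠ 0) :
    ∃ C : Submodule K M, Module.finrank K C + 1 ≤ Module.finrank K V ∧
      LinearMap.range L ≤ Submodule.span K {L v} ⊔ C := by
  obtain ⟨C, hC⟩ := Submodule.exists_isCompl (Submodule.span K {v})
  refine ⟨C.map L, ?_, ?_⟩
  · have h := Submodule.finrank_add_eq_of_isCompl hC
    rw [finrank_span_singleton hv] at h
    have := Submodule.finrank_map_le L C
    omega
  · rw [LinearMap.range_eq_map, ← hC.sup_eq_top, Submodule.map_sup, Submodule.map_span,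
      Set.image_singleton]

theorem finrank_segreTangent_segrePoint_le {n : ℕ} {a b : Fin 2 → K} {c d : Fin (n + 1) → K}
    (ha : a ≠ 0) (hb : b ≠ 0) (hc : c ≠ 0) (hd : d ≠ 0) :
    Module.finrank K (segreTangent K ![1, 1, n, n] (segrePoint a b c d)) ≤ 2 * n + 3 := by
  rw [segreTangent_segrePoint]
  obtain ⟨A, hA, hA'⟩ := LinearMap.exists_range_le_span_singleton_sup
    (((segreTensor K n).flip b).flip c |>.flip d) ha
  obtain ⟨B, hB, hB'⟩ := LinearMap.exists_range_le_span_singleton_sup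
    ((segreTensor K n a).flip c |>.flip d) hb
  obtain ⟨C, hC, hC'⟩ := LinearMap.exists_range_le_span_singleton_sup
    ((segreTensor K n a b).flip d) hc
  obtain ⟨D, hD, hD'⟩ := LinearMap.exists_range_le_span_singleton_sup
    (segreTensor K n a b c) hd
  simp only [LinearMap.flip_apply] at hA' hB' hC' hD'
  set P := Submodule.span K {segreTensor K n a b c d}
  have hP : Module.finrank K P ≤ 1 := by
    simpa using finrank_span_le_card ({segreTensor K n a b c d} : Set (SegreSpace K n))
  rw [Module.finrank_fin_fun] at hA hB hC hD
  have h1 := Submodule.finrank_add_le_finrank_add_finrank P A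
  have h2 := Submodule.finrank_add_le_finrank_add_finrank (P ⊔ A) B
  have h3 := Submodule.finrank_add_le_finrank_add_finrank (P ⊔ A ⊔ B) C
  have h4 := Submodule.finrank_add_le_finrank_add_finrank (P ⊔ A ⊔ B ⊔ C) D
  refine (Submodule.finrank_mono (t := P ⊔ A ⊔ B ⊔ C ⊔ D)
    (sup_le (sup_le (sup_le (hA'.trans ?_) (hB'.trans ?_)) (hC'.trans ?_)) (hD'.trans ?_))).trans
    (by omega)
  all_goals
    refine sup_le ?_ ?_
    · exact le_sup_of_le_left (le_sup_of_le_left (le_sup_of_le_left le_sup_left))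
  · exact le_sup_of_le_left (le_sup_of_le_left (le_sup_of_le_left le_sup_right))
  · exact le_sup_of_le_left (le_sup_of_le_left le_sup_right)
  · exact le_sup_of_le_left le_sup_right
  · exact le_sup_right

theorem finrank_segreTangent_le {n : ℕ} {v : ∀ i : Fin 4, Fin (![1, 1, n, n] i + 1) → K}
    (hv : ∀ i, v i ≠ 0) :
    Module.finrank K (segreTangent K ![1, 1, n, n] v) ≤ 2 * n + 3 :=
  segrePoint_eta v ▸ finrank_segreTangent_segrePoint_le (hv 0) (hv 1) (hv 2) (hv 3)

theorem Submodule.le_finrank_of_inf_ne_bot {M : Type*} [AddCommGroup M] [Module K M]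
    [FiniteDimensional K M] {A B : Submodule K M} (hAB : A ⊓ B ≠ ⊥) {m s t : ℕ}
    (hB : Module.finrank K B ≤ m) (h : s + m ≤ Module.finrank K (A ⊔ B : Submodule K M) + t) :
    s + 1 ≤ Module.finrank K A + t := by
  have h₁ := Submodule.finrank_sup_add_finrank_inf_eq A B
  have h₂ := Submodule.one_le_finrank_iff.2 hAB
  omega

theorem Submodule.finrank_iSup_le_sum {ι M : Type*} [Fintype ι] [AddCommGroup M] [Module K M]
    [FiniteDimensional K M] (T : ι → Submodule K M) :
    Module.finrank K (⨆ i, T i : Submodule K M) ≤ ∑ i, Module.finrank K (T i) := by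
  classical
  rw [← Finset.sup_univ_eq_iSup]
  induction (Finset.univ : Finset ι) using Finset.induction_on with
  | empty => simp
  | insert i s hi ih =>
    rw [Finset.sup_insert, Finset.sum_insert hi]
    exact (Submodule.finrank_add_le_finrank_add_finrank _ _).trans (by gcongr)

theorem finrank_iSup_segreTangent_le {ι : Type*} [Fintype ι] {n : ℕ}
    {p : ι → ∀ i : Fin 4, Fin (![1, 1, n, n] i + 1) → K} (hp : ∀ j i, p j i ≠ 0) :
    Module.finrank K (⨆ j, segreTangent K ![1, 1, n, n] (p j) : Submodule K (SegreSpace K n)) ≤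
      Fintype.card ι * (2 * n + 3) := by
  refine (Submodule.finrank_iSup_le_sum _).trans ?_
  refine (Finset.sum_le_card_nsmul _ _ (2 * n + 3) fun j _ =>
    finrank_segreTangent_le (hp j)).trans ?_
  simp

variable [CharZero K] {n : ℕ} {k : Fin n}

theorem iSup_segreBase_sup_segreExtra_sup_eq_top (hk : (k : ℕ) = 0)
    {S : Submodule K (SegreSpace K n)} (h : ∀ a, segreTensor K n (Pi.single a 1) (Pi.single 1 1)
      (Pi.single 0 1) (Pi.single 0 1) ∈ S) :
    (⨆ j, segreTangent K ![1, 1, n, n] (segreBase K n j)) ⊔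
      segreTangent K ![1, 1, n, n] (segreExtra K k) ⊔ S = ⊤ :=
  eq_top_of_segreTangent_le hk
    (fun j => le_sup_of_le_left <| le_sup_of_le_left <|
      le_iSup (fun j => segreTangent K ![1, 1, n, n] (segreBase K n j)) j)
    (le_sup_of_le_left le_sup_right) fun a => Submodule.mem_sup_right (h a)

theorem le_finrank_segreBase_sup_segreExtra (hk : (k : ℕ) = 0) :
    4 * (n + 1) ^ 2 ≤ Module.finrank K
      ((⨆ j, segreTangent K ![1, 1, n, n] (segreBase K n j)) ⊔
        segreTangent K ![1, 1, n, n] (segreExtra K k) : Submodule K (SegreSpace K n)) + 2 := by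
  let w : Fin 2 → SegreSpace K n := fun a =>
    segreTensor K n (Pi.single a 1) (Pi.single 1 1) (Pi.single 0 1) (Pi.single 0 1)
  have htop := iSup_segreBase_sup_segreExtra_sup_eq_top (K := K) hk
    (S := Submodule.span K (Set.range w)) fun a => Submodule.subset_span ⟨a, rfl⟩
  have h := Submodule.finrank_add_le_finrank_add_finrank
    ((⨆ j, segreTangent K ![1, 1, n, n] (segreBase K n j)) ⊔
        segreTangent K ![1, 1, n, n] (segreExtra K k) : Submodule K (SegreSpace K n))
    (Submodule.span K (Set.range w))
  rw [htop, finrank_top, finrank_segreSpace] at h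
  have := finrank_range_le_card (R := K) w
  rw [Set.finrank, Fintype.card_fin] at this
  omega

theorem segreTangent_segreExtra_inf_iSup_segreBase_ne_bot (hk : (k : ℕ) = 0) :
    (⨆ j, segreTangent K ![1, 1, n, n] (segreBase K n j)) ⊓
      segreTangent K ![1, 1, n, n] (segreExtra K k) ≠ ⊥ := by
  set u : Fin (n + 1) → K := Pi.single 0 1 + Pi.single k.succ 1
  set e : Fin (n + 1) → K := Pi.single k.succ 1
  have hk' : ((k : ℕ) : K) = 0 := by simp [hk]
  let r : SegreSpace K n := segreTensor K n (Pi.single 0 1) (Pi.single 0 1) u e +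
    segreTensor K n (Pi.single 1 1) (Pi.single 0 1 + Pi.single 1 1) u e
  have hr : r ≠ 0 := by
    intro h
    let f : ∀ i : Fin (n + 1), (Fin 2 → K) →ₗ[K] (Fin (n + 1) → K) →ₗ[K] K := fun i =>
      (LinearMap.proj 0).smulRight (LinearMap.proj i)
    have := congrArg (segreFunctional₁₃ (f 0) (f k.succ)) h
    simp [r, f, u, e] at this
  refine Submodule.ne_bot_iff _ |>.2 ⟨r, ⟨Submodule.add_mem _ ?_ ?_, ?_⟩, hr⟩
  · refine Submodule.mem_iSup_of_mem (Sum.inl k) ?_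
    simpa [hk'] using (segreTangent_le_iff.1
      (le_refl (segreTangent K ![1, 1, n, n] (segreBase K n (.inl k))))).2.2.1 u
  · refine Submodule.mem_iSup_of_mem (Sum.inr k) ?_
    simpa only [hk', zero_add, one_smul] using (segreTangent_le_iff.1
      (le_refl (segreTangent K ![1, 1, n, n] (segreBase K n (.inr k))))).2.2.2 e
  · have h := segreTangent_le_iff.1 (le_refl (segreTangent K ![1, 1, n, n] (segreExtra K k)))
    have hr' : r = segreTensor K n (Pi.single 0 1 + Pi.single 1 1) (Pi.single 0 1) u e +
        segreTensor K n (Pi.single 1 1) (Pi.single 1 1) u e := by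
      simp only [r, map_add, LinearMap.add_apply]
      abel
    rw [hr']
    exact Submodule.add_mem _ (h.2.1 _) (h.1 _)

theorem finrank_iSup_segreBase (hk : (k : ℕ) = 0) :
    Module.finrank K
      (⨆ j, segreTangent K ![1, 1, n, n] (segreBase K n j) : Submodule K (SegreSpace K n)) =
      2 * n * (2 * n + 3) := by
  apply le_antisymm
  · refine (finrank_iSup_segreTangent_le segreBase_ne_zero).trans ?_
    simp [two_mul]
  · refine Nat.add_le_add_iff_right (n := 2).1 (Submodule.le_finrank_of_inf_ne_bot
      (s := 2 * n * (2 * n + 3) + 1)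
      (segreTangent_segreExtra_inf_iSup_segreBase_ne_bot hk)
      (finrank_segreTangent_le (segreExtra_ne_zero k))
      (le_trans (le_of_eq ?_) (le_finrank_segreBase_sup_segreExtra hk)))
    ring

end Dimension

section UpperBound

variable {K : Type*} [Field K] {n : ℕ}

theorem exists_bilinear_ne_zero_of_card_lt {ι V W : Type*} [Fintype ι] [AddCommGroup V]
    [Module K V] [FiniteDimensional K V] [AddCommGroup W] [Module K W] [FiniteDimensional K W]
    (x : ι → V) (y : ι → W)
    (h : Fintype.card ι < Module.finrank K V * Module.finrank K W) :
    ∃ f : V →ₗ[K] W →ₗ[K] K, f ≠ 0 ∧ ∀ i, f (x i) (y i) = 0 := by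
  let E : (V →ₗ[K] W →ₗ[K] K) →ₗ[K] ι → K :=
    LinearMap.pi fun i => (LinearMap.applyₗ (y i)).comp (LinearMap.applyₗ (x i))
  have hE : LinearMap.ker E ≠ ⊥ := by
    refine LinearMap.ker_ne_bot_of_finrank_lt (K := K) (V := V →ₗ[K] W →ₗ[K] K)
      (V₂ := ι → K) ?_
    simpa [Module.finrank_linearMap] using h
  obtain ⟨f, hf, hf0⟩ := (Submodule.ne_bot_iff _).1 hE
  exact ⟨f, hf0, fun i => congrFun (LinearMap.mem_ker.1 hf) i⟩

theorem Submodule.finrank_add_two_le_of_linearIndependent {M : Type*} [AddCommGroup M]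
    [Module K M] [FiniteDimensional K M] {S : Submodule K M} {F G : Module.Dual K M}
    (hFG : LinearIndependent K ![F, G]) (hF : S ≤ LinearMap.ker F) (hG : S ≤ LinearMap.ker G) :
    Module.finrank K S + 2 ≤ Module.finrank K M := by
  have h := Subspace.finrank_add_finrank_dualAnnihilator_eq S
  have hle : Submodule.span K (Set.range ![F, G]) ≤ S.dualAnnihilator := by
    rw [Submodule.span_le]
    rintro _ ⟨i, rfl⟩
    fin_cases i
    · exact (Submodule.mem_dualAnnihilator _).2 fun w hw => hF hw
    · exact (Submodule.mem_dualAnnihilator _).2 fun w hw => hG hw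
  have h' := Submodule.finrank_mono hle
  rw [finrank_span_eq_card hFG, Fintype.card_fin] at h'
  omega

theorem segreTangent_le_ker_segreFunctional₁₃ {f g : (Fin 2 → K) →ₗ[K] (Fin (n + 1) → K) →ₗ[K] K}
    {a b : Fin 2 → K} {c d : Fin (n + 1) → K} (hf : f a c = 0) (hg : g b d = 0) :
    segreTangent K ![1, 1, n, n] (segrePoint a b c d) ≤
      LinearMap.ker (segreFunctional₁₃ f g) :=
  segreTangent_le_iff.2 (by simp [hf, hg])

theorem segreTangent_le_ker_segreFunctional₁₄ {f g : (Fin 2 → K) →ₗ[K] (Fin (n + 1) → K) →ₗ[K] K}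
    {a b : Fin 2 → K} {c d : Fin (n + 1) → K} (hf : f a d = 0) (hg : g b c = 0) :
    segreTangent K ![1, 1, n, n] (segrePoint a b c d) ≤
      LinearMap.ker (segreFunctional₁₄ f g) :=
  segreTangent_le_iff.2 (by simp [hf, hg])

/-- The span of the tensors `a ⊗ b ⊗ c ⊗ d` with `c` and `d` in given hyperplanes. -/
theorem exists_segreTensor_ker_mem {φ ψ : (Fin (n + 1) → K) →ₗ[K] K} (hφ : φ ≠ 0) (hψ : ψ ≠ 0) :
    ∃ S : Submodule K (SegreSpace K n), Module.finrank K S ≤ 4 * n ^ 2 ∧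
      ∀ a b c d, φ c = 0 → ψ d = 0 → segreTensor K n a b c d ∈ S := by
  have h₁ := Module.Dual.finrank_ker_add_one_of_ne_zero hφ
  have h₂ := Module.Dual.finrank_ker_add_one_of_ne_zero hψ
  rw [Module.finrank_fin_fun, Nat.add_right_cancel_iff] at h₁ h₂
  let u := Module.finBasisOfFinrankEq K _ h₁
  let w := Module.finBasisOfFinrankEq K _ h₂
  let t : (Fin 2 × Fin 2) × (Fin n × Fin n) → SegreSpace K n := fun i =>
    segreTensor K n (Pi.single i.1.1 1) (Pi.single i.1.2 1) (u i.2.1) (w i.2.2)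
  refine ⟨Submodule.span K (Set.range t), (finrank_range_le_card t).trans_eq ?_, ?_⟩
  · simp
    ring
  · intro a b c d hc hd
    have hc' : c = ∑ k, u.repr ⟨c, hc⟩ k • (u k : Fin (n + 1) → K) := by
      have h := congrArg Subtype.val (u.sum_repr ⟨c, hc⟩)
      rw [AddSubmonoidClass.coe_finsetSum] at h
      exact h.symm
    have hd' : d = ∑ k, w.repr ⟨d, hd⟩ k • (w k : Fin (n + 1) → K) := by
      have h := congrArg Subtype.val (w.sum_repr ⟨d, hd⟩)
      rw [AddSubmonoidClass.coe_finsetSum] at h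
      exact h.symm
    rw [pi_eq_sum_univ' a, pi_eq_sum_univ' b, hc', hd']
    simp only [map_sum, map_smul, LinearMap.sum_apply, LinearMap.smul_apply]
    refine sum_mem fun l _ => Submodule.smul_mem _ _ <| sum_mem fun k _ =>
      Submodule.smul_mem _ _ <| sum_mem fun j _ => Submodule.smul_mem _ _ <| sum_mem fun i _ =>
      Submodule.smul_mem _ _ <| Submodule.subset_span ?_
    exact ⟨((i, j), (k, l)), rfl⟩

theorem LinearMap.exists_smul_eq_of_mem_ker {φ : (Fin 2 → K) →ₗ[K] K} (hφ : φ ≠ 0) :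
    ∃ a, ∀ x, φ x = 0 → ∃ t : K, t • a = x := by
  have h := Module.Dual.finrank_ker_add_one_of_ne_zero hφ
  rw [Module.finrank_fin_fun, Nat.add_right_cancel_iff (k := 1) (n := 1)] at h
  obtain ⟨a, -, ha⟩ := finrank_eq_one_iff'.1 h
  exact ⟨a, fun x hx => (ha ⟨x, hx⟩).imp fun t ht => congrArg Subtype.val ht⟩

/-- The span of the tensors `a ⊗ b ⊗ c ⊗ d` with `c`, `d` in given hyperplanes or with `a`, `b`
in given lines. -/
theorem exists_segreTensor_ker_ker_mem {φ₁ φ₂ : (Fin 2 → K) →ₗ[K] K}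
    {φ₃ φ₄ : (Fin (n + 1) → K) →ₗ[K] K} (h₁ : φ₁ ≠ 0) (h₂ : φ₂ ≠ 0) (h₃ : φ₃ ≠ 0) (h₄ : φ₄ ≠ 0) :
    ∃ S : Submodule K (SegreSpace K n), Module.finrank K S ≤ 4 * n ^ 2 + 2 * (n + 1) ∧
      (∀ a b c d, φ₃ c = 0 → φ₄ d = 0 → segreTensor K n a b c d ∈ S) ∧
      (∀ a b c d, φ₁ a = 0 → φ₂ b = 0 → segreTensor K n a b c d ∈ S) := by
  obtain ⟨S, hS, hmem⟩ := exists_segreTensor_ker_mem h₃ h₄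
  obtain ⟨a₀, ha₀⟩ := LinearMap.exists_smul_eq_of_mem_ker h₁
  obtain ⟨b₀, hb₀⟩ := LinearMap.exists_smul_eq_of_mem_ker h₂
  obtain ⟨c₀, hc₀⟩ := LinearMap.surjective h₃ 1
  obtain ⟨d₀, hd₀⟩ := LinearMap.surjective h₄ 1
  let L := segreTensor K n a₀ b₀ c₀
  let R := (segreTensor K n a₀ b₀).flip d₀
  refine ⟨S ⊔ LinearMap.range L ⊔ LinearMap.range R, ?_,
    fun a b c d hc hd => Submodule.mem_sup_left <| Submodule.mem_sup_left <| hmem a b c d hc hd,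
    fun a b c d ha hb => ?_⟩
  · have hL : Module.finrank K (LinearMap.range L) ≤ n + 1 := by
      simpa using LinearMap.finrank_range_le L
    have hR : Module.finrank K (LinearMap.range R) ≤ n + 1 := by
      simpa using LinearMap.finrank_range_le R
    refine (Submodule.finrank_add_le_finrank_add_finrank _ _).trans ?_
    refine (Nat.add_le_add (Submodule.finrank_add_le_finrank_add_finrank _ _) hR).trans ?_
    refine (Nat.add_le_add_right (Nat.add_le_add hS hL) _).trans_eq (by ring)
  · obtain ⟨s, rfl⟩ := ha₀ a ha
    obtain ⟨t, rfl⟩ := hb₀ b hb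
    have h : segreTensor K n a₀ b₀ c d =
        segreTensor K n a₀ b₀ (c - φ₃ c • c₀) (d - φ₄ d • d₀) +
          L (φ₃ c • (d - φ₄ d • d₀)) + R (φ₄ d • c) := by
      simp only [L, R, map_sub, map_smul, LinearMap.sub_apply, LinearMap.smul_apply,
        LinearMap.flip_apply, smul_sub]
      rw [smul_comm (φ₃ c) (φ₄ d)]
      abel
    simp only [map_smul, LinearMap.smul_apply]
    refine Submodule.smul_mem _ _ (Submodule.smul_mem _ _ ?_)
    rw [h]
    refine add_mem (add_mem ?_ ?_) ?_
    · exact Submodule.mem_sup_left <| Submodule.mem_sup_left <|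
        hmem _ _ _ _ (by simp [hc₀]) (by simp [hd₀])
    · exact Submodule.mem_sup_left <| Submodule.mem_sup_right ⟨_, rfl⟩
    · exact Submodule.mem_sup_right ⟨_, rfl⟩

theorem finrank_iSup_segreTangent_add_two_le_of_ker {ι : Type*} [Fintype ι]
    (hι : Fintype.card ι = 2 * n + 1) (hn : 1 ≤ n) {a b : ι → Fin 2 → K}
    {c d : ι → Fin (n + 1) → K} {φ₁ φ₂ : (Fin 2 → K) →ₗ[K] K}
    {φ₃ φ₄ : (Fin (n + 1) → K) →ₗ[K] K} (h₁ : φ₁ ≠ 0) (h₂ : φ₂ ≠ 0) (h₃ : φ₃ ≠ 0) (h₄ : φ₄ ≠ 0)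
    (h : ∀ i, φ₁ (a i) = 0 ∧ φ₂ (b i) = 0 ∨ φ₃ (c i) = 0 ∧ φ₄ (d i) = 0) :
    Module.finrank K (⨆ i, segreTangent K ![1, 1, n, n] (segrePoint (a i) (b i) (c i) (d i)) :
      Submodule K (SegreSpace K n)) + 2 ≤ 4 * (n + 1) ^ 2 := by
  classical
  obtain ⟨S, hS, hcd, hab⟩ := exists_segreTensor_ker_ker_mem h₁ h₂ h₃ h₄
  obtain ⟨a₀, ha₀⟩ := LinearMap.surjective h₁ 1
  obtain ⟨b₀, hb₀⟩ := LinearMap.surjective h₂ 1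
  obtain ⟨c₀, hc₀⟩ := LinearMap.surjective h₃ 1
  obtain ⟨d₀, hd₀⟩ := LinearMap.surjective h₄ 1
  let u : ι → SegreSpace K n := fun i => if φ₁ (a i) = 0 ∧ φ₂ (b i) = 0
    then segreTensor K n a₀ (b i) (c i) (d i) else segreTensor K n (a i) (b i) c₀ (d i)
  let w : ι → SegreSpace K n := fun i => if φ₁ (a i) = 0 ∧ φ₂ (b i) = 0
    then segreTensor K n (a i) b₀ (c i) (d i) else segreTensor K n (a i) (b i) (c i) d₀
  let T := S ⊔ Submodule.span K (Set.range u) ⊔ Submodule.span K (Set.range w)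
  have hST : S ≤ T := le_sup_of_le_left le_sup_left
  have huT : ∀ i, u i ∈ T := fun i =>
    Submodule.mem_sup_left <| Submodule.mem_sup_right <| Submodule.subset_span ⟨i, rfl⟩
  have hwT : ∀ i, w i ∈ T := fun i => Submodule.mem_sup_right <| Submodule.subset_span ⟨i, rfl⟩
  have hT : Module.finrank K T ≤ 4 * n ^ 2 + 2 * (n + 1) + (2 * n + 1) + (2 * n + 1) := by
    refine (Submodule.finrank_add_le_finrank_add_finrank _ _).trans ?_
    refine Nat.add_le_add ((Submodule.finrank_add_le_finrank_add_finrank _ _).trans ?_)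
      ((finrank_range_le_card w).trans_eq hι)
    exact Nat.add_le_add hS ((finrank_range_le_card u).trans_eq hι)
  have hle : ⨆ i, segreTangent K ![1, 1, n, n] (segrePoint (a i) (b i) (c i) (d i)) ≤ T := by
    refine iSup_le fun i => segreTangent_le_iff.2 ?_
    have hu := huT i
    have hw := hwT i
    simp only [u, w] at hu hw
    split_ifs at hu hw with hi
    · obtain ⟨hai, hbi⟩ := hi
      refine ⟨fun x => ?_, fun x => ?_, fun y => hST (hab _ _ _ _ hai hbi),
        fun y => hST (hab _ _ _ _ hai hbi)⟩
      · rw [← sub_add_cancel x (φ₁ x • a₀)]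
        simp only [map_add, LinearMap.add_apply, map_smul (segreTensor K n), LinearMap.smul_apply]
        exact add_mem (hST (hab _ _ _ _ (by simp [ha₀]) hbi)) (T.smul_mem _ hu)
      · rw [← sub_add_cancel x (φ₂ x • b₀)]
        simp only [map_add, LinearMap.add_apply, map_smul (segreTensor K n _),
          LinearMap.smul_apply]
        exact add_mem (hST (hab _ _ _ _ hai (by simp [hb₀]))) (T.smul_mem _ hw)
    · obtain ⟨hci, hdi⟩ := (h i).resolve_left hi
      refine ⟨fun x => hST (hcd _ _ _ _ hci hdi), fun x => hST (hcd _ _ _ _ hci hdi),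
        fun y => ?_, fun y => ?_⟩
      · rw [← sub_add_cancel y (φ₃ y • c₀)]
        simp only [map_add, LinearMap.add_apply, map_smul (segreTensor K n _ _),
          LinearMap.smul_apply]
        exact add_mem (hST (hcd _ _ _ _ (by simp [hc₀]) hdi)) (T.smul_mem _ hu)
      · rw [← sub_add_cancel y (φ₄ y • d₀)]
        simp only [map_add, map_smul (segreTensor K n _ _ _)]
        exact add_mem (hST (hcd _ _ _ _ hci (by simp [hd₀]))) (T.smul_mem _ hw)
  have := (Submodule.finrank_mono hle).trans hT
  refine (Nat.add_le_add_right this 2).trans ?_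
  nlinarith

/-- If the products of two pairs of bilinear forms, pairing the same four vectors in two ways,
are proportional and the four forms vanish on a family of points, then each point lies on two out
of four hyperplanes. -/
theorem exists_ker_of_bilinear_mul_eq {ι V W : Type*} [AddCommGroup V] [Module K V]
    [AddCommGroup W] [Module K W] {f g f' g' : V →ₗ[K] W →ₗ[K] K} (hf : f ≠ 0) (hg : g ≠ 0)
    {t : K} (ht : t ≠ 0) (h : ∀ a b c d, f' a d * g' b c = t * (f a c * g b d))
    {a b : ι → V} {c d : ι → W} (hfi : ∀ i, f (a i) (c i) = 0) (hgi : ∀ i, g (b i) (d i) = 0)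
    (hfi' : ∀ i, f' (a i) (d i) = 0) (hgi' : ∀ i, g' (b i) (c i) = 0) :
    ∃ (φ₁ φ₂ : V →ₗ[K] K) (φ₃ φ₄ : W →ₗ[K] K), φ₁ ≠ 0 ∧ φ₂ ≠ 0 ∧ φ₃ ≠ 0 ∧ φ₄ ≠ 0 ∧
      ∀ i, φ₁ (a i) = 0 ∧ φ₂ (b i) = 0 ∨ φ₃ (c i) = 0 ∧ φ₄ (d i) = 0 := by
  obtain ⟨a₀, c₀, h₁⟩ : ∃ a c, f a c ≠ 0 := by
    contrapose! hf
    exact LinearMap.ext₂ hf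
  obtain ⟨b₀, d₀, h₂⟩ : ∃ b d, g b d ≠ 0 := by
    contrapose! hg
    exact LinearMap.ext₂ hg
  refine ⟨f.flip c₀, g.flip d₀, f a₀, g b₀, fun h => h₁ (LinearMap.congr_fun h a₀),
    fun h => h₂ (LinearMap.congr_fun h b₀), fun h => h₁ (LinearMap.congr_fun h c₀),
    fun h => h₂ (LinearMap.congr_fun h d₀), fun i => ?_⟩
  simp only [LinearMap.flip_apply]
  have h₁₄ : f (a i) c₀ = 0 ∨ g b₀ (d i) = 0 := by
    have := h (a i) b₀ c₀ (d i)
    simpa [hfi', ht] using this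
  have h₂₃ : f a₀ (c i) = 0 ∨ g (b i) d₀ = 0 := by
    have := h a₀ (b i) (c i) d₀
    simpa [hgi', ht] using this
  have h₁₃ : f (a i) c₀ = 0 ∨ f a₀ (c i) = 0 := by
    by_contra! H
    have e₁ := h (a i) b₀ c₀ d₀
    have e₂ := h a₀ b₀ (c i) d₀
    have e₃ := h (a i) b₀ (c i) d₀
    rw [hfi, zero_mul, mul_zero, mul_eq_zero] at e₃
    rcases e₃ with e₃ | e₃
    · rw [e₃, zero_mul, eq_comm] at e₁
      exact mul_ne_zero ht (mul_ne_zero H.1 h₂) e₁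
    · rw [e₃, mul_zero, eq_comm] at e₂
      exact mul_ne_zero ht (mul_ne_zero H.2 h₂) e₂
  have h₂₄ : g (b i) d₀ = 0 ∨ g b₀ (d i) = 0 := by
    by_contra! H
    have e₁ := h a₀ (b i) c₀ d₀
    have e₂ := h a₀ b₀ c₀ (d i)
    have e₃ := h a₀ (b i) c₀ (d i)
    rw [hgi, mul_zero, mul_zero, mul_eq_zero] at e₃
    rcases e₃ with e₃ | e₃
    · rw [e₃, zero_mul, eq_comm] at e₂
      exact mul_ne_zero ht (mul_ne_zero h₁ H.2) e₂
    · rw [e₃, mul_zero, eq_comm] at e₁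
      exact mul_ne_zero ht (mul_ne_zero h₁ H.1) e₁
  tauto

theorem finrank_iSup_segreTangent_add_two_le {ι : Type*} [Fintype ι]
    (hι : Fintype.card ι = 2 * n + 1) (hn : 1 ≤ n)
    (p : ι → ∀ i : Fin 4, Fin (![1, 1, n, n] i + 1) → K) :
    Module.finrank K (⨆ i, segreTangent K ![1, 1, n, n] (p i) :
      Submodule K (SegreSpace K n)) + 2 ≤ 4 * (n + 1) ^ 2 := by
  obtain ⟨a, b, c, d, rfl⟩ : ∃ (a b : ι → Fin 2 → K) (c d : ι → Fin (n + 1) → K),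
      p = fun i => segrePoint (a i) (b i) (c i) (d i) :=
    ⟨fun i => p i 0, fun i => p i 1, fun i => p i 2, fun i => p i 3,
      funext fun i => (segrePoint_eta (p i)).symm⟩
  have hcard : Fintype.card ι <
      Module.finrank K (Fin 2 → K) * Module.finrank K (Fin (n + 1) → K) := by
    rw [hι, Module.finrank_fin_fun, Module.finrank_fin_fun]
    omega
  obtain ⟨f, hf, hfi⟩ := exists_bilinear_ne_zero_of_card_lt a c hcard
  obtain ⟨g, hg, hgi⟩ := exists_bilinear_ne_zero_of_card_lt b d hcard
  obtain ⟨f', hf', hfi'⟩ := exists_bilinear_ne_zero_of_card_lt a d hcard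
  obtain ⟨g', hg', hgi'⟩ := exists_bilinear_ne_zero_of_card_lt b c hcard
  by_cases hF : LinearIndependent K ![segreFunctional₁₃ f g, segreFunctional₁₄ f' g']
  · rw [← finrank_segreSpace (K := K)]
    exact Submodule.finrank_add_two_le_of_linearIndependent hF
      (iSup_le fun i => segreTangent_le_ker_segreFunctional₁₃ (hfi i) (hgi i))
      (iSup_le fun i => segreTangent_le_ker_segreFunctional₁₄ (hfi' i) (hgi' i))
  · have hne : segreFunctional₁₃ f g ≠ 0 := fun h => by
      obtain ⟨x, hx⟩ := not_forall.1 (mt LinearMap.ext hf)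
      obtain ⟨y, hy⟩ := not_forall.1 (mt LinearMap.ext hx)
      obtain ⟨x', hx'⟩ := not_forall.1 (mt LinearMap.ext hg)
      obtain ⟨y', hy'⟩ := not_forall.1 (mt LinearMap.ext hx')
      have := LinearMap.congr_fun h (segreTensor K n x x' y y')
      rw [segreFunctional₁₃_segreTensor] at this
      exact mul_ne_zero hy hy' this
    have hne' : segreFunctional₁₄ f' g' ≠ 0 := fun h => by
      obtain ⟨x, hx⟩ := not_forall.1 (mt LinearMap.ext hf')
      obtain ⟨y, hy⟩ := not_forall.1 (mt LinearMap.ext hx)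
      obtain ⟨x', hx'⟩ := not_forall.1 (mt LinearMap.ext hg')
      obtain ⟨y', hy'⟩ := not_forall.1 (mt LinearMap.ext hx')
      have := LinearMap.congr_fun h (segreTensor K n x x' y' y)
      rw [segreFunctional₁₄_segreTensor] at this
      exact mul_ne_zero hy hy' this
    rw [LinearIndependent.pair_iff' hne] at hF
    push Not at hF
    obtain ⟨t, ht⟩ := hF
    have ht0 : t ≠ 0 := by
      rintro rfl
      exact hne' (by rw [← ht, zero_smul])
    obtain ⟨φ₁, φ₂, φ₃, φ₄, h₁, h₂, h₃, h₄, h⟩ := exists_ker_of_bilinear_mul_eq hf hg ht0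
      (fun a b c d => by
        simpa using (LinearMap.congr_fun ht (segreTensor K n a b c d)).symm) hfi hgi hfi' hgi'
    exact finrank_iSup_segreTangent_add_two_le_of_ker hι hn h₁ h₂ h₃ h₄ h

end UpperBound

theorem finrank_sup_iSup_segreG_of_isEmpty {K : Type*} [Field K] {k : ℕ} {n : Fin k → ℕ}
    (S : Submodule K (⨂[K] i, (Fin (n i + 1) → K))) {ι : Fin k → Type*} [∀ i, IsEmpty (ι i)]
    (q : ∀ i, ι i → ∀ j, Fin (n j + 1) → K) :
    Module.finrank K (S ⊔ ⨆ i, ⨆ l, segreG K n (q i l) i : Submodule K _) =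
      Module.finrank K S := by
  rw [sup_eq_left.2 (iSup_le fun i => iSup_le fun l => isEmptyElim l)]

theorem exists_fin_iSup_segreTangent_eq {K ι : Type*} [Field K] [Fintype ι] {n s : ℕ}
    (hι : Fintype.card ι = s) {p : ι → ∀ i : Fin 4, Fin (![1, 1, n, n] i + 1) → K}
    (hp : ∀ j i, p j i ≠ 0) :
    ∃ q : Fin s → ∀ i : Fin 4, Fin (![1, 1, n, n] i + 1) → K, (∀ j i, q j i ≠ 0) ∧
      ⨆ j, segreTangent K ![1, 1, n, n] (q j) = ⨆ j, segreTangent K ![1, 1, n, n] (p j) :=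
  let e := (Fintype.equivFinOfCardEq hι).symm
  ⟨fun j => p (e j), fun j => hp (e j),
    e.iSup_comp (g := fun j => segreTangent K ![1, 1, n, n] (p j))⟩

/-- For `n ≥ 1` and the Segre variety `X = P¹ × P¹ × Pⁿ × Pⁿ`:
(i) `T(1,1,n,n; 2n+1; 0,0,0,0)` fails (the `(2n+1)`-secant variety is defective);
(ii) the codimension of `σ_{2n+1}(X)` is exactly `2`: the maximal dimension of the span
of the tangent spaces at `2n+1` points is `4(n+1)² − 2`;
(iii) `T(1,1,n,n; 2n; 0,…,0)` holds and `T(1,1,n,n; 2n+2; 0,…,0)` holds, i.e. there exist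
`2n+2` points whose tangent spaces span the whole space, of dimension `4(n+1)²`. -/
theorem P1P1PnPn_secants
    (K : Type*) [Field K] [CharZero K] (n : ℕ) (hn : 1 ≤ n) :
    TFails K ![1, 1, n, n] (2 * n + 1) (fun _ => 0) ∧
    ((∀ p : Fin (2 * n + 1) → ∀ i, Fin (![1, 1, n, n] i + 1) → K,
        (∀ j i, p j i ≠ 0) →
        Module.finrank K ((⨆ j, segreTangent K ![1, 1, n, n] (p j))
            : Submodule K (⨂[K] i, (Fin (![1, 1, n, n] i + 1) → K)))
          ≤ 4 * (n + 1) ^ 2 - 2) ∧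
      (∃ p : Fin (2 * n + 1) → ∀ i, Fin (![1, 1, n, n] i + 1) → K,
        (∀ j i, p j i ≠ 0) ∧
        Module.finrank K ((⨆ j, segreTangent K ![1, 1, n, n] (p j))
            : Submodule K (⨂[K] i, (Fin (![1, 1, n, n] i + 1) → K)))
          = 4 * (n + 1) ^ 2 - 2)) ∧
    THolds K ![1, 1, n, n] (2 * n) (fun _ => 0) ∧
    (∃ p : Fin (2 * n + 2) → ∀ i, Fin (![1, 1, n, n] i + 1) → K,
      (∀ j i, p j i ≠ 0) ∧
      (⨆ j, segreTangent K ![1, 1, n, n] (p j))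
        = (⊤ : Submodule K (⨂[K] i, (Fin (![1, 1, n, n] i + 1) → K)))) := by
  have hk : ((⟨0, hn⟩ : Fin n) : ℕ) = 0 := rfl
  have hsum : ∑ i, (![1, 1, n, n] : Fin 4 → ℕ) i = 2 * n + 2 := by
    simp [Fin.sum_univ_four]
    ring
  have hprod : ∏ i, ((![1, 1, n, n] : Fin 4 → ℕ) i + 1) = 4 * (n + 1) ^ 2 := by
    simp [Fin.prod_univ_four]
    ring
  have hupper (p : Fin (2 * n + 1) → ∀ i : Fin 4, Fin (![1, 1, n, n] i + 1) → K) :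
      Module.finrank K (⨆ j, segreTangent K ![1, 1, n, n] (p j) : Submodule K (SegreSpace K n))
        ≤ 4 * (n + 1) ^ 2 - 2 :=
    Nat.le_sub_of_add_le (finrank_iSup_segreTangent_add_two_le (Fintype.card_fin _) hn p)
  refine ⟨fun p q _ _ => ?_, ⟨fun p _ => hupper p, ?_⟩, ?_, ?_⟩
  · have : ∀ i : Fin 4, IsEmpty (Fin ((fun _ => 0 : Fin 4 → ℕ) i)) := fun _ => Fin.isEmpty
    refine (finrank_sup_iSup_segreG_of_isEmpty _ q).trans_lt ((hupper p).trans_lt ?_)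
    rw [hsum, hprod]
    simp only [zero_mul, Finset.sum_const_zero]
    refine lt_min ?_ ?_
    · rw [tsub_lt_iff_right] <;> nlinarith
    · rw [tsub_lt_iff_right] <;> nlinarith
  · let p₀ : Option (Fin n ⊕ Fin n) → ∀ i : Fin 4, Fin (![1, 1, n, n] i + 1) → K :=
      fun j => j.elim (segreExtra K ⟨0, hn⟩) (segreBase K n)
    obtain ⟨p, hp, hp'⟩ := exists_fin_iSup_segreTangent_eq (p := p₀) (s := 2 * n + 1)
      (by simp [two_mul]) (by
        rintro (_ | j)
        exacts [segreExtra_ne_zero _, segreBase_ne_zero j])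
    refine ⟨p, hp, (hupper p).antisymm ?_⟩
    rw [hp', iSup_option, sup_comm]
    exact Nat.sub_le_of_le_add (le_finrank_segreBase_sup_segreExtra hk)
  · obtain ⟨p, hp, hp'⟩ := exists_fin_iSup_segreTangent_eq (s := 2 * n) (by simp [two_mul])
      (segreBase_ne_zero (K := K) (n := n))
    refine ⟨p, fun _ l => l.elim0, hp, fun _ l => l.elim0, ?_⟩
    have : ∀ i : Fin 4, IsEmpty (Fin ((fun _ => 0 : Fin 4 → ℕ) i)) := fun _ => Fin.isEmpty
    refine (finrank_sup_iSup_segreG_of_isEmpty _ _).trans ?_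
    rw [hp', hsum, hprod]
    refine (finrank_iSup_segreBase hk).trans ?_
    simp only [zero_mul, Finset.sum_const_zero]
    rw [min_eq_left (by nlinarith)]
    ring
  · let p₀ : Option (Option (Fin n ⊕ Fin n)) → ∀ i : Fin 4, Fin (![1, 1, n, n] i + 1) → K :=
      fun j => j.elim (segrePoint (Pi.single 0 1) (Pi.single 1 1) (Pi.single 0 1) (Pi.single 0 1))
        fun j => j.elim (segreExtra K ⟨0, hn⟩) (segreBase K n)
    obtain ⟨p, hp, hp'⟩ := exists_fin_iSup_segreTangent_eq (p := p₀) (s := 2 * n + 2)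
      (by simp [two_mul]) (by
        rintro (_ | _ | j)
        exacts [segrePoint_ne_zero (by simp) (by simp) (by simp) (by simp),
          segreExtra_ne_zero _, segreBase_ne_zero j])
    refine ⟨p, hp, ?_⟩
    rw [hp', iSup_option, iSup_option, sup_comm, sup_comm (segreTangent K _ (p₀ (some none)))]
    exact iSup_segreBase_sup_segreExtra_sup_eq_top hk fun a =>
      (segreTangent_le_iff.1 le_rfl).1 _
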